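/- arXiv:math/0703392 — 2 statements merged into one kernel-verified Lean document; each statement's English description precedes it below -/
import Mathlib

section
/- Fix a prime number p and a real number β > 1. Then the function λ ↦ Z_p(λ,β) is strictly increasing on the interval (1,p]: for all 1 < λ₁ < λ₂ ≤ p one has Z_p(λ₁,β) < Z_p(λ₂,β). -/
/-- `a p lam k = ⌈lam * p^k - 1⌉`, the number of positive integers in `(0, lam·p^k)`. -/
noncomputable def a (p : ℕ) (lam : ℝ) (k : ℤ) : ℤ := ⌈lam * (p : ℝ) ^ k - 1⌉

/-- The partition function `Z_p(λ,β) = 2 Σ_{k≥0} (a_k(λ) − a_{k−1}(λ)) p^{−kβ}`. -/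
noncomputable def Z (p : ℕ) (lam β : ℝ) : ℝ :=
  2 * ∑' k : ℕ, ((a p lam (k : ℤ) - a p lam ((k : ℤ) - 1) : ℤ) : ℝ) * (p : ℝ) ^ (-(k : ℝ) * β)

lemma a_mono (p : ℕ) (k : ℤ) : Monotone fun lam : ℝ => a p lam k := by
  intro lam₁ lam₂ h
  have hk : (0 : ℝ) ≤ (p : ℝ) ^ k := zpow_nonneg (Nat.cast_nonneg p) k
  exact Int.ceil_mono (by gcongr)

lemma a_nonneg {p : ℕ} (hp : 0 < p) {lam : ℝ} (hlam : 0 < lam) (k : ℤ) : 0 ≤ a p lam k := by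
  have hk : 0 < (p : ℝ) ^ k := zpow_pos (by exact_mod_cast hp) k
  have h : (-1 : ℤ) < a p lam k := by
    refine Int.lt_ceil.2 ?_
    push_cast
    linarith [mul_pos hlam hk]
  lia

lemma a_lt (p : ℕ) (lam : ℝ) (k : ℤ) : (a p lam k : ℝ) < lam * (p : ℝ) ^ k := by
  have h := Int.ceil_lt_add_one (lam * (p : ℝ) ^ k - 1)
  unfold a
  linarith

lemma a_neg_one {p : ℕ} (hp : 0 < p) {lam : ℝ} (h0 : 0 < lam) (h : lam ≤ p) :
    a p lam (-1) = 0 := by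
  have hp' : (0 : ℝ) < p := by exact_mod_cast hp
  have h1 : 0 < lam / p := div_pos h0 hp'
  have h2 : lam / p ≤ 1 := (div_le_one hp').2 h
  rw [a, Int.ceil_eq_zero_iff, zpow_neg_one, ← div_eq_mul_inv]
  constructor <;> linarith

/-- If `lam₁ < lam₂`, then `a p lam₁ k < a p lam₂ k` for some `k ≥ 0`. -/
lemma exists_a_lt {p : ℕ} (hp : 1 < p) {lam₁ lam₂ : ℝ} (h : lam₁ < lam₂) :
    ∃ k : ℕ, a p lam₁ k < a p lam₂ k := by
  have hp' : (1 : ℝ) < p := by exact_mod_cast hp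
  obtain ⟨k, hk⟩ := pow_unbounded_of_one_lt (1 / (lam₂ - lam₁)) hp'
  refine ⟨k, ?_⟩
  rw [div_lt_iff₀ (by linarith)] at hk
  have h1 := a_lt p lam₁ k
  have h2 := Int.le_ceil (lam₂ * (p : ℝ) ^ (k : ℤ) - 1)
  rw [zpow_natCast] at h1
  have h3 : (a p lam₁ k : ℝ) < a p lam₂ k := by
    refine lt_of_lt_of_le ?_ h2
    rw [zpow_natCast]
    linarith
  exact_mod_cast h3

lemma summable_a_mul_pow {p : ℕ} (hp : 0 < p) {lam x : ℝ} (hlam : 0 < lam) (hx : 0 ≤ x)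
    (hpx : p * x < 1) : Summable fun k : ℕ => (a p lam k : ℝ) * x ^ k := by
  have hg : Summable fun k : ℕ => lam * (p * x) ^ k :=
    (summable_geometric_of_lt_one (by positivity) hpx).mul_left lam
  refine hg.of_nonneg_of_le (fun k => ?_) (fun k => ?_)
  · have : (0 : ℝ) ≤ a p lam k := by exact_mod_cast a_nonneg hp hlam k
    positivity
  · have h := (a_lt p lam k).le
    rw [zpow_natCast] at h
    rw [mul_pow, ← mul_assoc]
    gcongr

/-- Summation by parts for the series defining the partition function. -/
lemma Z_eq {p : ℕ} (hp : 0 < p) {lam β : ℝ} (h0 : 0 < lam) (hlam : lam ≤ p)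
    (hpx : p * (p : ℝ) ^ (-β) < 1) :
    Z p lam β = 2 * ((1 - (p : ℝ) ^ (-β)) * ∑' k : ℕ, (a p lam k : ℝ) * ((p : ℝ) ^ (-β)) ^ k) := by
  have hpow : ∀ k : ℕ, (p : ℝ) ^ (-(k : ℝ) * β) = ((p : ℝ) ^ (-β)) ^ k := by
    intro k
    rw [← Real.rpow_natCast, ← Real.rpow_mul (Nat.cast_nonneg p)]
    ring_nf
  simp only [Z, hpow]
  set x : ℝ := (p : ℝ) ^ (-β)
  have hx : 0 ≤ x := Real.rpow_nonneg (Nat.cast_nonneg p) _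
  have hs := summable_a_mul_pow hp h0 hx hpx
  have hshift : ∀ k : ℕ, (a p lam (((k + 1 : ℕ) : ℤ) - 1) : ℝ) * x ^ (k + 1) =
      x * ((a p lam k : ℝ) * x ^ k) := by
    intro k
    have : ((k + 1 : ℕ) : ℤ) - 1 = k := by push_cast; ring
    rw [this]
    ring
  have hs' : Summable fun k : ℕ => (a p lam ((k : ℤ) - 1) : ℝ) * x ^ k := by
    rw [← summable_nat_add_iff 1]
    simp only [hshift]
    exact hs.mul_left x
  have ht : ∑' k : ℕ, (a p lam ((k : ℤ) - 1) : ℝ) * x ^ k =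
      x * ∑' k : ℕ, (a p lam k : ℝ) * x ^ k := by
    rw [hs'.tsum_eq_zero_add]
    simp only [hshift, tsum_mul_left]
    simp [a_neg_one hp h0 hlam]
  simp only [Int.cast_sub, sub_mul]
  rw [hs.tsum_sub hs', ht]
  ring

/-- For a prime `p` and `β > 1`, the partition function `λ ↦ Z_p(λ,β)` is strictly
increasing on `(1,p]`. -/
theorem Z_strictMono (p : ℕ) (hp : p.Prime) (β : ℝ) (hβ : 1 < β) :
    ∀ lam₁ lam₂ : ℝ, 1 < lam₁ → lam₁ < lam₂ → lam₂ ≤ p → Z p lam₁ β < Z p lam₂ β := by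
  intro lam₁ lam₂ h1 h12 h2
  have hp' : (1 : ℝ) < p := by exact_mod_cast hp.one_lt
  have hpx : p * (p : ℝ) ^ (-β) < 1 := by
    rw [← Real.rpow_one_add' (by positivity) (by linarith)]
    exact Real.rpow_lt_one_of_one_lt_of_neg hp' (by linarith)
  have hx : 0 < (p : ℝ) ^ (-β) := by positivity
  have hx1 : (p : ℝ) ^ (-β) < 1 := Real.rpow_lt_one_of_one_lt_of_neg hp' (by linarith)
  rw [Z_eq hp.pos (by linarith) (by linarith) hpx, Z_eq hp.pos (by linarith) h2 hpx]
  obtain ⟨k, hk⟩ := exists_a_lt hp.one_lt h12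
  have hlt : ∑' k : ℕ, (a p lam₁ k : ℝ) * ((p : ℝ) ^ (-β)) ^ k <
      ∑' k : ℕ, (a p lam₂ k : ℝ) * ((p : ℝ) ^ (-β)) ^ k := by
    refine Summable.tsum_lt_tsum (i := k) (fun n => ?_) ?_
      (summable_a_mul_pow hp.pos (by linarith) hx.le hpx)
      (summable_a_mul_pow hp.pos (by linarith) hx.le hpx)
    · have : (a p lam₁ n : ℝ) ≤ a p lam₂ n := by exact_mod_cast a_mono p n h12.le
      gcongr
    · have : (a p lam₁ k : ℝ) < a p lam₂ k := by exact_mod_cast hk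
      gcongr
  have : 0 < 1 - (p : ℝ) ^ (-β) := by linarith
  gcongr
end

section
/- Fix a prime number p and a real number β > 1. Let λ₀ = m p^{−k} ∈ (1,p) with k ≥ 0 an integer and m a positive integer coprime to p. Then λ ↦ Z_p(λ,β) has a jump discontinuity at λ₀ of size 2 p^{−kβ}: the right limit satisfies lim_{λ → λ₀⁺} Z_p(λ,β) = Z_p(λ₀,β) + 2 p^{−kβ}. -/
lemma eventually_nhdsGT_a_eq (p : ℕ) (hp : 0 < p) (x : ℝ) (j : ℤ) :
    ∀ᶠ y in nhdsWithin x (Set.Ioi x), a p y j = ⌊x * (p : ℝ) ^ j⌋ := by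
  have hpj : (0 : ℝ) < (p : ℝ) ^ j := by positivity
  have hcont : Filter.Tendsto (fun y : ℝ => y * (p : ℝ) ^ j) (nhdsWithin x (Set.Ioi x))
      (nhds (x * (p : ℝ) ^ j)) :=
    ((continuous_id.mul continuous_const).tendsto x).mono_left nhdsWithin_le_nhds
  filter_upwards [hcont.eventually (gt_mem_nhds (Int.lt_floor_add_one (x * (p : ℝ) ^ j))),
    self_mem_nhdsWithin] with y hy hxy
  have hlt : x * (p : ℝ) ^ j < y * (p : ℝ) ^ j := mul_lt_mul_of_pos_right hxy hpj
  have hfl := Int.floor_le (x * (p : ℝ) ^ j)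
  rw [a, Int.ceil_eq_iff]
  constructor <;> linarith

lemma a_eq_floor_of_ne_intCast (p : ℕ) (x : ℝ) (j : ℤ) (h : ∀ n : ℤ, x * (p : ℝ) ^ j ≠ n) :
    a p x j = ⌊x * (p : ℝ) ^ j⌋ := by
  have hfl := lt_of_le_of_ne (Int.floor_le (x * (p : ℝ) ^ j)) (h _).symm
  have hlt := Int.lt_floor_add_one (x * (p : ℝ) ^ j)
  rw [a, Int.ceil_eq_iff]
  constructor <;> linarith

lemma a_eq_floor_sub_one_of_eq_intCast (p : ℕ) (x : ℝ) (j n : ℤ) (h : x * (p : ℝ) ^ j = n) :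
    a p x j = ⌊x * (p : ℝ) ^ j⌋ - 1 := by
  rw [a, h, Int.floor_intCast, Int.ceil_sub_one, Int.ceil_intCast]

lemma mul_zpow_ne_intCast_of_lt {p m : ℕ} (hp : p.Prime) (hcop : Nat.Coprime m p) {k j : ℤ}
    (hj : j < k) (n : ℤ) : (m : ℝ) * (p : ℝ) ^ (-k) * (p : ℝ) ^ j ≠ n := by
  have hp0 : (p : ℝ) ≠ 0 := by exact_mod_cast hp.ne_zero
  intro h
  obtain ⟨d, hd⟩ : ∃ d : ℕ, k - j = d + 1 := ⟨(k - j - 1).toNat, by omega⟩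
  have hm : (m : ℝ) = n * (p : ℝ) ^ (d + 1) := by
    rw [← h, ← zpow_natCast, mul_assoc, mul_assoc, ← zpow_add₀ hp0, ← zpow_add₀ hp0]
    rw [show -k + (j + ((d + 1 : ℕ) : ℤ)) = 0 by push_cast; omega]
    simp
  have hm' : (m : ℤ) = n * (p : ℤ) ^ (d + 1) := by exact_mod_cast hm
  have hdvd : (p : ℤ) ∣ m := by
    rw [hm']
    exact Dvd.dvd.mul_left (dvd_pow_self _ (Nat.succ_ne_zero d)) _
  have hdvd' : p ∣ m := by exact_mod_cast hdvd
  exact hp.one_lt.ne' (Nat.Coprime.eq_one_of_dvd hcop.symm hdvd')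

lemma eventually_nhdsGT_a_eq_add {p m : ℕ} (hp : p.Prime) (hcop : Nat.Coprime m p) (k j : ℤ) :
    ∀ᶠ y in nhdsWithin ((m : ℝ) * (p : ℝ) ^ (-k)) (Set.Ioi ((m : ℝ) * (p : ℝ) ^ (-k))),
      a p y j = a p ((m : ℝ) * (p : ℝ) ^ (-k)) j + if k ≤ j then 1 else 0 := by
  have hp0 : (p : ℝ) ≠ 0 := by exact_mod_cast hp.ne_zero
  filter_upwards [eventually_nhdsGT_a_eq p hp.pos ((m : ℝ) * (p : ℝ) ^ (-k)) j] with y hy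
  rw [hy]
  split_ifs with hkj
  · obtain ⟨d, hd⟩ : ∃ d : ℕ, j = k + d := ⟨(j - k).toNat, by omega⟩
    rw [a_eq_floor_sub_one_of_eq_intCast p _ j ((m : ℤ) * (p : ℤ) ^ d), sub_add_cancel]
    rw [hd, mul_assoc, ← zpow_add₀ hp0, neg_add_cancel_left]
    push_cast
    rw [zpow_natCast]
  · rw [a_eq_floor_of_ne_intCast p _ j (mul_zpow_ne_intCast_of_lt hp hcop (not_le.1 hkj)),
      add_zero]

lemma a_nonneg_s11 {p : ℕ} (hp : 0 < p) {x : ℝ} (hx : 0 < x) (j : ℤ) : 0 ≤ a p x j := by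
  have h : 0 < x * (p : ℝ) ^ j := by positivity
  rw [a, Int.ceil_sub_one]
  have := Int.ceil_pos.2 h
  omega

lemma a_le (p : ℕ) (x : ℝ) (j : ℤ) : (a p x j : ℝ) ≤ x * (p : ℝ) ^ j := by
  have := Int.ceil_lt_add_one (x * (p : ℝ) ^ j - 1)
  rw [a]
  linarith

lemma norm_term_le {p : ℕ} (hp : 0 < p) (β : ℝ) {x : ℝ} (hx : 0 < x) (hxp : x ≤ p) (j : ℕ) :
    ‖((a p x (j : ℤ) - a p x ((j : ℤ) - 1) : ℤ) : ℝ) * (p : ℝ) ^ (-(j : ℝ) * β)‖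
      ≤ p * ((p : ℝ) ^ (1 - β)) ^ j := by
  have hp' : (1 : ℝ) ≤ p := by exact_mod_cast hp
  have hp0 : (0 : ℝ) < p := by linarith
  have hle : ∀ i : ℤ, i ≤ j → (a p x i : ℝ) ≤ p * (p : ℝ) ^ j := by
    intro i hi
    refine (a_le p x i).trans ?_
    rw [← zpow_natCast (p : ℝ) j]
    gcongr
  have hnn : ∀ i : ℤ, (0 : ℝ) ≤ a p x i := fun i => by exact_mod_cast a_nonneg_s11 hp hx i
  have hdiff : |((a p x (j : ℤ) - a p x ((j : ℤ) - 1) : ℤ) : ℝ)| ≤ p * (p : ℝ) ^ j := by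
    push_cast
    rw [abs_le]
    constructor <;> linarith [hle j le_rfl, hle (j - 1) (by omega), hnn j, hnn (j - 1)]
  have hpow : ((p : ℝ) ^ (1 - β)) ^ j = (p : ℝ) ^ j * (p : ℝ) ^ (-(j : ℝ) * β) := by
    rw [← Real.rpow_natCast, ← Real.rpow_natCast, ← Real.rpow_mul hp0.le, ← Real.rpow_add hp0]
    congr 1
    ring
  have hr : (0 : ℝ) < (p : ℝ) ^ (-(j : ℝ) * β) := Real.rpow_pos_of_pos hp0 _
  rw [norm_mul, Real.norm_eq_abs, Real.norm_of_nonneg hr.le, hpow, ← mul_assoc]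
  exact mul_le_mul_of_nonneg_right hdiff hr.le

lemma summable_bound {p : ℕ} (hp : 1 < p) {β : ℝ} (hβ : 1 < β) :
    Summable fun j : ℕ => (p : ℝ) * ((p : ℝ) ^ (1 - β)) ^ j := by
  have hp' : (1 : ℝ) < p := by exact_mod_cast hp
  exact (summable_geometric_of_lt_one (by positivity)
    (Real.rpow_lt_one_of_one_lt_of_neg hp' (by linarith))).mul_left _

/-- For a prime `p`, `β > 1` and `λ₀ = m p^{−k} ∈ (1,p)` with `m` a positive integer
coprime to `p`, the function `λ ↦ Z_p(λ,β)` has a jump of size `2 p^{−kβ}` at `λ₀`: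
the limit from the right equals `Z_p(λ₀,β) + 2 p^{−kβ}`. -/
theorem Z_jump_at_rational
    (p : ℕ) (hp : p.Prime) (β : ℝ) (hβ : 1 < β) (k : ℕ) (m : ℕ) (hm : 0 < m)
    (hcop : Nat.Coprime m p) (lam₀ : ℝ) (hlam₀ : lam₀ = (m : ℝ) * (p : ℝ) ^ (-(k : ℤ)))
    (h1 : 1 < lam₀) (h2 : lam₀ < p) :
    Filter.Tendsto (fun lam => Z p lam β) (nhdsWithin lam₀ (Set.Ioi lam₀))
      (nhds (Z p lam₀ β + 2 * (p : ℝ) ^ (-(k : ℝ) * β))) := by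
  have hsum : Summable fun j : ℕ =>
      ((a p lam₀ (j : ℤ) - a p lam₀ ((j : ℤ) - 1) : ℤ) : ℝ) * (p : ℝ) ^ (-(j : ℝ) * β) :=
    Summable.of_norm_bounded (summable_bound hp.one_lt hβ)
      (norm_term_le hp.pos β (by linarith) h2.le)
  have hlim : Z p lam₀ β + 2 * (p : ℝ) ^ (-(k : ℝ) * β) = 2 * ∑' j : ℕ,
      (((a p lam₀ (j : ℤ) - a p lam₀ ((j : ℤ) - 1) : ℤ) : ℝ) * (p : ℝ) ^ (-(j : ℝ) * β) +
        if j = k then (p : ℝ) ^ (-(k : ℝ) * β) else 0) := by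
    have hs := hasSum_ite_eq k ((p : ℝ) ^ (-(k : ℝ) * β))
    rw [hsum.tsum_add hs.summable, hs.tsum_eq, Z, mul_add]
  rw [hlim]
  refine Filter.Tendsto.const_mul 2
    (tendsto_tsum_of_dominated_convergence (summable_bound hp.one_lt hβ) ?_ ?_)
  · intro j
    refine tendsto_const_nhds.congr' ?_
    have hj := eventually_nhdsGT_a_eq_add hp hcop k j
    have hj' := eventually_nhdsGT_a_eq_add hp hcop k (j - 1)
    rw [← hlam₀] at hj hj'
    filter_upwards [hj, hj'] with y hy hy'
    rw [hy, hy']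
    rcases lt_trichotomy j k with h | rfl | h
    · rw [if_neg h.ne, if_neg (by omega), if_neg (by omega)]
      simp
    · rw [if_pos rfl, if_pos le_rfl, if_neg (by omega)]
      push_cast
      ring
    · rw [if_neg h.ne', if_pos (by omega), if_pos (by omega)]
      push_cast
      ring
  · filter_upwards [Ioo_mem_nhdsGT h2] with y hy
    exact norm_term_le hp.pos β (by linarith [hy.1]) hy.2.le
end
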